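/- Let X be a uniform space whose uniformity is induced by a metric. Then X is weakly chained if and only if X is both chain connected and locally uniformly joinable. -/

import Mathlib

/-! Basic definitions: chains, `E`-homotopy, generalized paths, and the
joinability properties of uniform spaces, following Brodskiy–Dydak–LaBuz–Mitra
and Plaut. -/

/-- A subset `A` of `X` is `E`-bounded if `A × A ⊆ E`. -/
def IsEBounded {X : Type*} (E : Set (X × X)) (A : Set X) : Prop :=
  ∀ a ∈ A, ∀ b ∈ A, (a, b) ∈ E

/-- A list of points is an `E`-chain if every pair of consecutive points
belongs to `E`. -/
def IsEChain {X : Type*} (E : Set (X × X)) (c : List X) : Prop :=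
  c.Chain' fun a b => (a, b) ∈ E

/-- `c` is an `E`-chain from `x` to `y`. -/
def IsEChainFromTo {X : Type*} (E : Set (X × X)) (c : List X) (x y : X) : Prop :=
  IsEChain E c ∧ c.head? = some x ∧ c.getLast? = some y

/-- A basic move inserts a single point `z` between two consecutive points
`a`, `b` of a chain, in such a way that `{a, z, b}` is `E`-bounded. -/
def BasicMove {X : Type*} (E : Set (X × X)) (c d : List X) : Prop :=
  ∃ (p q : List X) (a z b : X),
    IsEBounded E {a, z, b} ∧ c = p ++ a :: b :: q ∧ d = p ++ a :: z :: b :: q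

/-- Two `E`-chains are `E`-homotopic if one can be obtained from the other by a
finite sequence of basic moves (insertions or deletions); endpoints are kept
fixed automatically. -/
def EHomotopic {X : Type*} (E : Set (X × X)) : List X → List X → Prop :=
  Relation.EqvGen (BasicMove E)

/-- A generalized path from `x` to `y` in a uniform space `X`: a compatible
family of (`E`-homotopy classes of) `E`-chains from `x` to `y`, indexed by the
entourages `E` of `X`.  It is recorded by a choice of representative chain for
each entourage, such that for `F ⊆ E` the representative at `F` is
`E`-homotopic to the representative at `E` (this determines, and is determined
by, the family of homotopy classes). -/
structure GenPath {X : Type*} [UniformSpace X] (x y : X) where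
  /-- a representative `E`-chain for each entourage `E` -/
  chain : ∀ E : Set (X × X), E ∈ uniformity X → List X
  isChain : ∀ (E : Set (X × X)) (hE : E ∈ uniformity X),
    IsEChainFromTo E (chain E hE) x y
  compat : ∀ (F E : Set (X × X)) (hF : F ∈ uniformity X) (hE : E ∈ uniformity X),
    F ⊆ E → EHomotopic E (chain F hF) (chain E hE)

/-- A generalized path from `x` to `y` is `E`-short if its `E`-level homotopy
class is the class of the two-point chain `x, y`. -/
def GenPath.EShort {X : Type*} [UniformSpace X] {x y : X} (α : GenPath x y)
    (E : Set (X × X)) : Prop :=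
  ∀ hE : E ∈ uniformity X, EHomotopic E (α.chain E hE) [x, y]

/-- `X` is chain connected if for every entourage `E`, every pair of points of
`X` can be joined by an `E`-chain. -/
def ChainConnected (X : Type*) [UniformSpace X] : Prop :=
  ∀ E ∈ uniformity X, ∀ x y : X, ∃ c : List X, IsEChainFromTo E c x y

/-- `X` is uniformly joinable if every pair of points can be joined by a
generalized path. -/
def UniformlyJoinable (X : Type*) [UniformSpace X] : Prop :=
  ∀ x y : X, Nonempty (GenPath x y)

/-- `X` is locally uniformly joinable if for every entourage `E` there is an
entourage `F` such that any pair `(x, y) ∈ F` can be joined by an `E`-short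
generalized path. -/
def LocallyUniformlyJoinable (X : Type*) [UniformSpace X] : Prop :=
  ∀ E ∈ uniformity X, ∃ F ∈ uniformity X, ∀ x y : X, (x, y) ∈ F →
    ∃ α : GenPath x y, α.EShort E

/-- `X` is weakly chained if it is chain connected and for every entourage `E`
there is an entourage `F ⊆ E` such that every pair `(x, y) ∈ F` can be joined
by arbitrarily fine chains that are `E`-short (i.e. for every entourage `G`
there is a `G`-chain from `x` to `y` that is `E`-homotopic to the two-point
chain `x, y`). -/
def WeaklyChained (X : Type*) [UniformSpace X] : Prop :=
  ChainConnected X ∧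
    ∀ E ∈ uniformity X, ∃ F ∈ uniformity X, F ⊆ E ∧
      ∀ x y : X, (x, y) ∈ F → ∀ G ∈ uniformity X,
        ∃ c : List X, IsEChainFromTo G c x y ∧ EHomotopic E c [x, y]

theorem BasicMove.append {X : Type*} {E : Set (X × X)} {c d : List X} (h : BasicMove E c d)
    (p q : List X) : BasicMove E (p ++ c ++ q) (p ++ d ++ q) := by
  obtain ⟨p', q', a, z, b, hb, rfl, rfl⟩ := h
  exact ⟨p ++ p', q' ++ q, a, z, b, hb, by simp, by simp⟩

namespace EHomotopic

variable {X : Type*} {E F : Set (X × X)} {c d e : List X}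

theorem refl (c : List X) : EHomotopic E c c := Relation.EqvGen.refl c

theorem symm (h : EHomotopic E c d) : EHomotopic E d c := Relation.EqvGen.symm _ _ h

theorem trans (h : EHomotopic E c d) (h' : EHomotopic E d e) : EHomotopic E c e :=
  Relation.EqvGen.trans _ _ _ h h'

theorem mono (hEF : E ⊆ F) (h : EHomotopic E c d) : EHomotopic F c d := by
  refine Relation.EqvGen.mono ?_ _ _ h
  rintro _ _ ⟨p, q, a, z, b, hb, hc, hd⟩
  exact ⟨p, q, a, z, b, fun u hu v hv => hEF (hb u hu v hv), hc, hd⟩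

theorem append (h : EHomotopic E c d) (p q : List X) :
    EHomotopic E (p ++ c ++ q) (p ++ d ++ q) := by
  induction h with
  | rel _ _ h => exact Relation.EqvGen.rel _ _ (h.append p q)
  | refl _ => exact refl _
  | symm _ _ _ ih => exact ih.symm
  | trans _ _ _ _ _ ih ih' => exact ih.trans ih'

end EHomotopic

theorem IsEChainFromTo.mono {X : Type*} {E F : Set (X × X)} {c : List X} {x y : X} (hEF : E ⊆ F)
    (h : IsEChainFromTo E c x y) : IsEChainFromTo F c x y :=
  ⟨List.IsChain.imp (fun _ _ hab => hEF hab) h.1, h.2⟩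

/-- If every link in `F` can be replaced by an `E`-short `G`-chain, then every `F`-chain is
`E`-homotopic to a `G`-chain with the same endpoints. -/
theorem IsEChainFromTo.exists_refinement {X : Type*} {E F G : Set (X × X)}
    (hF : ∀ x y : X, (x, y) ∈ F → ∃ c : List X, IsEChainFromTo G c x y ∧ EHomotopic E c [x, y])
    {c : List X} {x y : X} (hc : IsEChainFromTo F c x y) :
    ∃ d : List X, IsEChainFromTo G d x y ∧ EHomotopic E d c := by
  induction c generalizing x with
  | nil => simp [IsEChainFromTo] at hc
  | cons a l ih =>
    obtain ⟨hch, hhead, hlast⟩ := hc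
    obtain rfl : a = x := by simpa using hhead
    cases l with
    | nil => exact ⟨[a], ⟨List.isChain_singleton _, hhead, hlast⟩, .refl _⟩
    | cons b l =>
      obtain ⟨hab, hbl⟩ := List.isChain_cons_cons.1 hch
      obtain ⟨d, ⟨hd, hdh, hdl⟩, hdc⟩ := ih (x := b) ⟨hbl, rfl, by simpa using hlast⟩
      obtain ⟨e, ⟨he, heh, hel⟩, hee⟩ := hF a b hab
      obtain ⟨t, rfl⟩ := List.head?_eq_some_iff.1 hdh
      refine ⟨e ++ t, ⟨List.isChain_append.2 ⟨he, List.IsChain.tail hd, ?_⟩, ?_, ?_⟩, ?_⟩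
      · intro u hu v hv
        obtain rfl : b = u := by simpa [hel] using hu
        exact (List.isChain_cons.1 hd).1 v hv
      · simp [heh]
      · cases t with
        | nil => simpa [hel] using hdl
        | cons u t => simpa using hdl
      · have h₁ := hee.append [] t
        have h₂ := hdc.append [a] []
        simp only [List.nil_append, List.append_nil, List.cons_append] at h₁ h₂
        exact h₁.trans h₂

/-- A sequence of `E n`-chains, for `E` a decreasing basis of the uniformity, whose successive
terms are `E n`-homotopic defines a generalized path, whose chains are terms of the sequence. -/
theorem exists_genPath_of_seq {X : Type*} [UniformSpace X] {E : ℕ → Set (X × X)}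
    (hE : Antitone E) (hbasis : ∀ G ∈ uniformity X, ∃ n, E n ⊆ G) {x y : X} {c : ℕ → List X}
    (hc : ∀ n, IsEChainFromTo (E n) (c n) x y)
    (hcc : ∀ n, EHomotopic (E n) (c (n + 1)) (c n)) :
    ∃ α : GenPath x y, ∀ G (hG : G ∈ uniformity X), E 0 ⊆ G →
      EHomotopic G (α.chain G hG) (c 0) := by
  choose N hN using hbasis
  have hle : ∀ m n, m ≤ n → EHomotopic (E m) (c n) (c m) := by
    intro m n hmn
    induction n, hmn using Nat.le_induction with
    | base => exact .refl _
    | succ n hmn ih => exact ((hcc n).mono (hE hmn)).trans ih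
  refine ⟨⟨fun G hG => c (N G hG), fun G hG => (hc _).mono (hN G hG), ?_⟩, ?_⟩
  · intro H G hH hG hHG
    rcases le_total (N H hH) (N G hG) with h | h
    · exact ((hle _ _ h).mono ((hN H hH).trans hHG)).symm
    · exact (hle _ _ h).mono (hN G hG)
  · intro G hG h
    exact (hle _ _ (Nat.zero_le _)).mono h

theorem WeaklyChained.locallyUniformlyJoinable {X : Type*} [UniformSpace X]
    [(uniformity X).IsCountablyGenerated] (h : WeaklyChained X) :
    LocallyUniformlyJoinable X := by
  intro E₀ hE₀
  obtain ⟨u, hu⟩ := (uniformity X).exists_antitone_basis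
  let E : ℕ → Set (X × X) := fun n => u n ∩ E₀
  have hEmem : ∀ n, E n ∈ uniformity X := fun n => Filter.inter_mem (hu.mem n) hE₀
  have hE : Antitone E := fun m n hmn => Set.inter_subset_inter_left _ (hu.antitone hmn)
  have hbasis : ∀ G ∈ uniformity X, ∃ n, E n ⊆ G := fun G hG =>
    let ⟨n, hn⟩ := hu.mem_iff.1 hG
    ⟨n, Set.inter_subset_left.trans hn⟩
  choose F hFmem hFE hF using fun n => h.2 (E n) (hEmem n)
  refine ⟨F 0, hFmem 0, fun x y hxy => ?_⟩
  have hstep : ∀ (n : ℕ) (c : {c : List X // IsEChainFromTo (F n) c x y}),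
      ∃ d : {d : List X // IsEChainFromTo (F (n + 1)) d x y}, EHomotopic (E n) d.1 c.1 := by
    intro n c
    obtain ⟨d, hd, hdc⟩ := c.2.exists_refinement (G := F (n + 1)) (E := E n)
      fun a b hab => hF n a b hab _ (hFmem _)
    exact ⟨⟨d, hd⟩, hdc⟩
  choose next hnext using hstep
  let c : (n : ℕ) → {c : List X // IsEChainFromTo (F n) c x y} := fun n =>
    Nat.rec ⟨[x, y], List.isChain_pair.2 hxy, rfl, rfl⟩ next n
  obtain ⟨α, hα⟩ := exists_genPath_of_seq (c := fun n => (c n).1) hE hbasis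
    (fun n => (c n).2.mono (hFE n)) (fun n => hnext n (c n))
  exact ⟨α, fun hG => hα E₀ hG Set.inter_subset_right⟩

theorem LocallyUniformlyJoinable.weaklyChained {X : Type*} [UniformSpace X]
    (h : LocallyUniformlyJoinable X) (hX : ChainConnected X) : WeaklyChained X := by
  refine ⟨hX, fun E hE => ?_⟩
  obtain ⟨F, hF, hFE⟩ := h E hE
  refine ⟨F ∩ E, Filter.inter_mem hF hE, Set.inter_subset_right, fun x y hxy G hG => ?_⟩
  obtain ⟨α, hα⟩ := hFE x y hxy.1
  have hGE := Filter.inter_mem hG hE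
  exact ⟨α.chain _ hGE, (α.isChain _ hGE).mono Set.inter_subset_left,
    (α.compat _ E hGE hE Set.inter_subset_right).trans (hα hE)⟩

/-- A metrizable uniform space is weakly chained if and only if it is both
chain connected and locally uniformly joinable. -/
theorem weaklyChained_iff_chainConnected_and_locallyUniformlyJoinable
    {X : Type*} [MetricSpace X] :
    WeaklyChained X ↔ ChainConnected X ∧ LocallyUniformlyJoinable X :=
  ⟨fun h => ⟨h.1, h.locallyUniformlyJoinable⟩, fun h => h.2.weaklyChained h.1⟩
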